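/- arXiv:1106.0048 — 2 statements merged into one kernel-verified Lean document; each statement's English description precedes it below -/
import Mathlib

section
/- Let c ∈ (0,∞) and let (p_n)_{n≥2} be a sequence in (0,1) with n·p_n → c as n → ∞. Then there exists a positive constant k, depending only on c and the sequence, such that for all n ≥ 2 and all t ≥ 0 the number Y_n of isolated vertices in G(n,p_n) satisfies P((Y_n - μ_n)/σ_n ≥ t) ≤ exp(-k t²). -/
open MeasureTheory ProbabilityTheory Real Finset

noncomputable section

namespace ErdosRenyiIsolated

/-- Index set for the potential edges of a graph on `Fin n`. -/
abbrev EdgeIdx (n : ℕ) := {e : Fin n × Fin n // e.1 < e.2}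

/-- Adjacency relation of the random graph encoded by `ω` : `u` and `v` are adjacent
if the corresponding edge indicator is `true`. -/
def adj {n : ℕ} (ω : EdgeIdx n → Bool) (u v : Fin n) : Prop :=
  if h : u < v then ω ⟨(u, v), h⟩ = true
  else if h' : v < u then ω ⟨(v, u), h'⟩ = true
  else False

instance {n : ℕ} (ω : EdgeIdx n → Bool) (u v : Fin n) : Decidable (adj ω u v) := by
  unfold adj
  split
  · exact inferInstance
  · split
    · exact inferInstance
    · exact inferInstance

/-- Degree of vertex `v` in the graph encoded by `ω`. -/
def deg {n : ℕ} (ω : EdgeIdx n → Bool) (v : Fin n) : ℕ :=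
  (Finset.univ.filter fun w => adj ω v w).card

/-- The number of isolated vertices of the graph encoded by `ω`. -/
def isolCount {n : ℕ} (ω : EdgeIdx n → Bool) : ℕ :=
  (Finset.univ.filter fun v => deg ω v = 0).card

/-- The Bernoulli(p) measure on `Bool`. -/
def bern (p : ℝ) : Measure Bool :=
  ENNReal.ofReal p • Measure.dirac true + ENNReal.ofReal (1 - p) • Measure.dirac false

instance (p : ℝ) : IsFiniteMeasure (bern p) := by
  constructor
  have h : bern p Set.univ ≤ ENNReal.ofReal p + ENNReal.ofReal (1 - p) := by
    simp [bern]
  exact lt_of_le_of_lt h (ENNReal.add_lt_top.mpr ⟨ENNReal.ofReal_lt_top, ENNReal.ofReal_lt_top⟩)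

/-- The Erdős–Rényi random graph measure `G(n,p)`: the edge indicators are i.i.d.
Bernoulli(p). -/
def gnp (n : ℕ) (p : ℝ) : Measure (EdgeIdx n → Bool) :=
  Measure.pi fun _ => bern p

/-- The Erdős–Rényi measure together with an independent uniformly chosen vertex. -/
def gnpV (n : ℕ) (p : ℝ) : Measure ((EdgeIdx n → Bool) × Fin n) :=
  (gnp n p).prod (uniformOn (Set.univ : Set (Fin n)))

/-- Adjacency in the graph obtained by deleting all edges incident to `v'`. -/
def adjDel {n : ℕ} (ω : EdgeIdx n → Bool) (v' u v : Fin n) : Prop :=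
  adj ω u v ∧ u ≠ v' ∧ v ≠ v'

instance {n : ℕ} (ω : EdgeIdx n → Bool) (v' u v : Fin n) : Decidable (adjDel ω v' u v) := by
  unfold adjDel; exact inferInstance

/-- Degree of `v` in the graph `ω` with all edges incident to `v'` deleted. -/
def degDel {n : ℕ} (ω : EdgeIdx n → Bool) (v' v : Fin n) : ℕ :=
  (Finset.univ.filter fun w => adjDel ω v' v w).card

/-- Number of isolated vertices in the graph `ω` with all edges incident to `v'` deleted. -/
def isolCountDel {n : ℕ} (ω : EdgeIdx n → Bool) (v' : Fin n) : ℕ :=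
  (Finset.univ.filter fun v => degDel ω v' v = 0).card

/-- The point masses of the Bernoulli(p) law. -/
def bernWeight (p : ℝ) (b : Bool) : ℝ := if b then p else 1 - p

/-- The point masses of the product of Bernoulli(p) laws. -/
def prodWeight {ι : Type*} [Fintype ι] (p : ℝ) (ω : ι → Bool) : ℝ := ∏ i, bernWeight p (ω i)

/-- Changing a single coordinate changes `f` by at most `2`. -/
def BoundedDiff {ι : Type*} (f : (ι → Bool) → ℝ) : Prop :=
  ∀ i ω ω', (∀ j, j ≠ i → ω j = ω' j) → |f ω - f ω'| ≤ 2

lemma bernWeight_nonneg {p : ℝ} (h0 : 0 ≤ p) (h1 : p ≤ 1) (b : Bool) : 0 ≤ bernWeight p b := by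
  cases b <;> simp [bernWeight, h0, h1]

lemma prodWeight_nonneg {ι : Type*} [Fintype ι] {p : ℝ} (h0 : 0 ≤ p) (h1 : p ≤ 1)
    (ω : ι → Bool) : 0 ≤ prodWeight p ω :=
  Finset.prod_nonneg fun _ _ => bernWeight_nonneg h0 h1 _

lemma sum_bernWeight (p : ℝ) : ∑ b, bernWeight p b = 1 := by
  simp [bernWeight]

lemma two_point_exp_le {p θ a b : ℝ} (h0 : 0 ≤ p) (hθ : 0 ≤ θ) (hθ' : θ ≤ 1 / 2)
    (hab : |a - b| ≤ 2) :
    p * exp (θ * a) + (1 - p) * exp (θ * b)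
      ≤ exp (θ * (p * a + (1 - p) * b) + 4 * p * θ ^ 2) := by
  set s := θ * (a - b) with hs
  have hs1 : |s| ≤ 1 := by
    rw [hs, abs_mul, abs_of_nonneg hθ]
    nlinarith [abs_nonneg (a - b)]
  have hs2 : s ^ 2 ≤ 4 * θ ^ 2 := by
    have : (a - b) ^ 2 ≤ 2 ^ 2 := sq_le_sq' (abs_le.1 hab).1 (abs_le.1 hab).2
    rw [hs, mul_pow]
    nlinarith [sq_nonneg θ]
  have hexp : exp s ≤ 1 + s + s ^ 2 := by
    have := (abs_le.1 (Real.abs_exp_sub_one_sub_id_le hs1)).2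
    linarith
  have hfac : p * exp (θ * a) + (1 - p) * exp (θ * b)
      = exp (θ * b) * (p * (exp s - 1) + 1) := by
    have : θ * a = θ * b + s := by rw [hs]; ring
    rw [this, exp_add]; ring
  rw [hfac]
  calc exp (θ * b) * (p * (exp s - 1) + 1)
      ≤ exp (θ * b) * exp (p * (exp s - 1)) := by gcongr; exact add_one_le_exp _
    _ = exp (θ * b + p * (exp s - 1)) := (exp_add _ _).symm
    _ ≤ _ := by
      apply exp_le_exp.2
      have h1 : p * (exp s - 1) ≤ p * (s + 4 * θ ^ 2) :=
        mul_le_mul_of_nonneg_left (by linarith) h0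
      have h2 : θ * (p * a + (1 - p) * b) = θ * b + p * s := by rw [hs]; ring
      rw [h2]; linarith

/-- Bernstein-type bound on the moment generating function of a function with bounded
differences of independent Bernoulli variables. -/
theorem sum_prodWeight_exp_le {p θ : ℝ} (h0 : 0 ≤ p) (h1 : p ≤ 1) (hθ : 0 ≤ θ)
    (hθ' : θ ≤ 1 / 2) (ι : Type*) [Fintype ι] [DecidableEq ι] :
    ∀ f : (ι → Bool) → ℝ, BoundedDiff f →
      ∑ ω, prodWeight p ω * exp (θ * f ω)
        ≤ exp (θ * ∑ ω, prodWeight p ω * f ω + Fintype.card ι * (4 * p * θ ^ 2)) := by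
  classical
  suffices H : ∀ f : (ι → Bool) → ℝ, BoundedDiff f →
      ∑ ω, prodWeight p ω * exp (θ * f ω)
        ≤ exp (θ * ∑ ω, prodWeight p ω * f ω + Nat.card ι * (4 * p * θ ^ 2)) by
    simpa only [Nat.card_eq_fintype_card] using H
  have key := Fintype.induction_empty_option
    (P := fun α _ => ∀ f : (α → Bool) → ℝ, BoundedDiff f →
      ∑ᶠ ω, prodWeight p ω * exp (θ * f ω)
        ≤ exp (θ * ∑ᶠ ω, prodWeight p ω * f ω + Nat.card α * (4 * p * θ ^ 2)))
    ?_ ?_ ?_ ι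
  · simpa only [finsum_eq_sum_of_fintype] using key
  · intro α β _ e ih f hf
    let _ := Fintype.ofEquiv β e.symm
    have hw : ∀ ω : α → Bool, prodWeight p (fun b => ω (e.symm b)) = prodWeight p ω :=
      fun ω => Fintype.prod_equiv e.symm _ _ fun _ => rfl
    have hg : BoundedDiff fun ω : α → Bool => f fun b => ω (e.symm b) := by
      intro i ω ω' h
      refine hf (e i) _ _ fun j hj => h _ fun hji => hj ?_
      rw [← hji, Equiv.apply_symm_apply]
    have hE : ∀ F : (β → Bool) → ℝ, ∑ᶠ ω, F ω = ∑ᶠ ω : α → Bool, F fun b => ω (e.symm b) :=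
      fun F => (finsum_comp_equiv (e.arrowCongr (Equiv.refl Bool)) (f := F)).symm
    have := ih _ hg
    rw [hE, hE, ← Nat.card_congr e]
    simpa only [hw] using this
  · intro f _
    simp [finsum_eq_sum_of_fintype, prodWeight]
  · intro α _ ih f hf
    simp only [finsum_eq_sum_of_fintype] at ih ⊢
    let E : (Option α → Bool) ≃ Bool × (α → Bool) := Equiv.piOptionEquivProd
    let F : Bool → (α → Bool) → ℝ := fun b ω => f (E.symm (b, ω))
    let g : (α → Bool) → ℝ := fun ω => p * F true ω + (1 - p) * F false ω
    have hW : ∀ b ω, prodWeight p (E.symm (b, ω)) = bernWeight p b * prodWeight p ω := by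
      intro b ω
      simp [prodWeight, Fintype.prod_option, E, Equiv.piOptionEquivProd]
    have hsum : ∀ G : ℝ → ℝ, ∑ ω, prodWeight p ω * G (f ω)
        = ∑ ω, prodWeight p ω * (p * G (F true ω) + (1 - p) * G (F false ω)) := by
      intro G
      rw [← E.symm.sum_comp, Fintype.sum_prod_type_right]
      refine Finset.sum_congr rfl fun ω _ => ?_
      simp only [hW, Fintype.sum_bool, F]
      simp only [bernWeight]
      simp
      ring
    have hF : ∀ b, BoundedDiff (F b) := by
      intro b i ω ω' h
      refine hf (some i) _ _ fun j hj => ?_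
      cases j with
      | none => simp [E, Equiv.piOptionEquivProd]
      | some j => simpa [E, Equiv.piOptionEquivProd] using h j fun hji => hj (by rw [hji])
    have hg : BoundedDiff g := by
      intro i ω ω' h
      have ht := abs_le.1 (hF true i ω ω' h)
      have hff := abs_le.1 (hF false i ω ω' h)
      refine abs_le.2 ⟨?_, ?_⟩ <;> simp only [g] <;> nlinarith
    have hd : ∀ ω, |F true ω - F false ω| ≤ 2 := by
      intro ω
      refine hf none _ _ fun j hj => ?_
      cases j with
      | none => exact absurd rfl hj
      | some j => simp [E, Equiv.piOptionEquivProd]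
    have hmean := hsum id
    simp only [id] at hmean
    rw [hsum fun x => exp (θ * x), hmean]
    calc _ ≤ ∑ ω, prodWeight p ω * (exp (θ * g ω) * exp (4 * p * θ ^ 2)) := by
            refine Finset.sum_le_sum fun ω _ => mul_le_mul_of_nonneg_left ?_
              (prodWeight_nonneg h0 h1 ω)
            rw [← exp_add]
            exact two_point_exp_le h0 hθ hθ' (hd ω)
      _ = (∑ ω, prodWeight p ω * exp (θ * g ω)) * exp (4 * p * θ ^ 2) := by
            rw [Finset.sum_mul]
            exact Finset.sum_congr rfl fun ω _ => by ring
      _ ≤ exp (θ * ∑ ω, prodWeight p ω * g ω + Nat.card α * (4 * p * θ ^ 2))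
            * exp (4 * p * θ ^ 2) := by gcongr; exact ih g hg
      _ = _ := by
            rw [← exp_add, Finite.card_option]
            congr 1
            push_cast
            simp only [g]
            ring

lemma gnp_toReal_eq {n : ℕ} {p : ℝ} (h0 : 0 ≤ p) (h1 : p ≤ 1) (S : Set (EdgeIdx n → Bool))
    [DecidablePred (· ∈ S)] :
    ((gnp n p) S).toReal = ∑ ω with ω ∈ S, prodWeight p ω := by
  have hS : S = ((Finset.univ.filter (· ∈ S) : Finset (EdgeIdx n → Bool)) : Set _) := by
    ext; simp
  have : IsFiniteMeasure (gnp n p) := by unfold gnp; infer_instance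
  change (gnp n p).real S = _
  conv_lhs => rw [hS]
  rw [← sum_measureReal_singleton]
  refine Finset.sum_congr rfl fun ω _ => ?_
  rw [measureReal_def, gnp, Measure.pi_singleton, ENNReal.toReal_prod]
  refine Finset.prod_congr rfl fun e _ => ?_
  cases ω e <;> simp [bern, bernWeight, h0, h1]

/-- The edges incident to `v` all being absent is equivalent to `v` being isolated. -/
lemma deg_eq_zero_iff {n : ℕ} (ω : EdgeIdx n → Bool) (v : Fin n) :
    deg ω v = 0 ↔ ∀ e : EdgeIdx n, e.1.1 = v ∨ e.1.2 = v → ω e = false := by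
  rw [deg, Finset.card_eq_zero, Finset.filter_eq_empty_iff]
  constructor
  · rintro h ⟨⟨a, b⟩, hab⟩ (rfl | rfl)
    · have := h (Finset.mem_univ b)
      simpa [adj, show a < b from hab] using this
    · have := h (Finset.mem_univ a)
      simpa [adj, show a < b from hab, (show a < b from hab).le.not_gt] using this
  · intro h w _
    unfold adj
    split_ifs with h1 h2
    · simp [h ⟨(v, w), h1⟩ (Or.inl rfl)]
    · simp [h ⟨(w, v), h2⟩ (Or.inr rfl)]
    · simp

lemma boundedDiff_isolCount (n : ℕ) :
    BoundedDiff fun ω : EdgeIdx n → Bool => (isolCount ω : ℝ) := by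
  have key : ∀ (e : EdgeIdx n) (ω ω' : EdgeIdx n → Bool), (∀ j, j ≠ e → ω j = ω' j) →
      isolCount ω ≤ isolCount ω' + 2 := by
    intro e ω ω' h
    have hsub : (Finset.univ.filter fun v => deg ω v = 0)
        ⊆ (Finset.univ.filter fun v => deg ω' v = 0) ∪ {e.1.1, e.1.2} := by
      intro v hv
      simp only [Finset.mem_filter, Finset.mem_univ, true_and, Finset.mem_union,
        Finset.mem_insert, Finset.mem_singleton, deg_eq_zero_iff] at hv ⊢
      by_contra! hcon
      obtain ⟨⟨j, hj, hjω⟩, hv1, hv2⟩ := hcon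
      have hje : j ≠ e := by
        rintro rfl
        rcases hj with hj | hj
        · exact hv1 hj.symm
        · exact hv2 hj.symm
      exact hjω (h j hje ▸ hv j hj)
    calc isolCount ω ≤ _ := Finset.card_le_card hsub
      _ ≤ _ := Finset.card_union_le _ _
      _ ≤ isolCount ω' + 2 := Nat.add_le_add_left Finset.card_le_two _
  intro e ω ω' h
  have h1 : (isolCount ω : ℝ) ≤ isolCount ω' + 2 := by exact_mod_cast key e ω ω' h
  have h2 : (isolCount ω' : ℝ) ≤ isolCount ω + 2 := by
    exact_mod_cast key e ω' ω fun j hj => (h j hj).symm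
  exact abs_le.2 ⟨by linarith, by linarith⟩

lemma card_incident {n : ℕ} (v : Fin n) :
    (Finset.univ.filter fun e : EdgeIdx n => e.1.1 = v ∨ e.1.2 = v).card = n - 1 := by
  have hc : (Finset.univ.erase v).card = n - 1 := by simp
  rw [← hc]
  refine Finset.card_bij' (fun e _ => if e.1.1 = v then e.1.2 else e.1.1)
    (fun w hw => if h : w < v then ⟨(w, v), h⟩
      else ⟨(v, w), lt_of_le_of_ne (not_lt.1 h) (Finset.ne_of_mem_erase hw).symm⟩)
    ?_ ?_ ?_ ?_
  · rintro ⟨⟨a, b⟩, hab⟩ _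
    have hab' : a < b := hab
    by_cases h : a = v
    · subst h; simp [hab'.ne']
    · simp [h]
  · intro w hw
    by_cases h : w < v <;> simp [h]
  · rintro ⟨⟨a, b⟩, hab⟩ he
    have hab' : a < b := hab
    simp only [Finset.mem_filter, Finset.mem_univ, true_and] at he
    by_cases h : a = v
    · subst h; simp [hab'.le.not_gt]
    · obtain rfl := he.resolve_left h
      simp [h, hab']
  · intro w hw
    have hwv : w ≠ v := Finset.ne_of_mem_erase hw
    by_cases h : w < v <;> simp [h, hwv]

lemma sum_prodWeight_isolated {n : ℕ} (p : ℝ) (v : Fin n) :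
    ∑ ω : EdgeIdx n → Bool, prodWeight p ω * (if deg ω v = 0 then 1 else 0)
      = (1 - p) ^ (n - 1) := by
  let u : EdgeIdx n → Bool → ℝ := fun e b =>
    bernWeight p b * if (e.1.1 = v ∨ e.1.2 = v) → b = false then 1 else 0
  have h1 : ∀ ω : EdgeIdx n → Bool,
      prodWeight p ω * (if deg ω v = 0 then 1 else 0) = ∏ e, u e (ω e) := by
    intro ω
    simp only [u, Finset.prod_mul_distrib, Finset.prod_ite_zero, Finset.prod_const_one,
      deg_eq_zero_iff, prodWeight, Finset.mem_univ, true_imp_iff]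
  have h2 : ∀ e : EdgeIdx n, ∑ b, u e b = if e.1.1 = v ∨ e.1.2 = v then 1 - p else 1 := by
    intro e
    by_cases h : e.1.1 = v ∨ e.1.2 = v <;> simp [u, h, bernWeight]
  rw [Finset.sum_congr rfl fun ω _ => h1 ω, ← Fintype.prod_sum,
    Finset.prod_congr rfl fun e _ => h2 e, Finset.prod_ite, Finset.prod_const,
    Finset.prod_const_one, mul_one, card_incident]

lemma sum_prodWeight_isolCount (n : ℕ) (p : ℝ) :
    ∑ ω : EdgeIdx n → Bool, prodWeight p ω * (isolCount ω : ℝ) = n * (1 - p) ^ (n - 1) := by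
  have h : ∀ ω : EdgeIdx n → Bool, (isolCount ω : ℝ) = ∑ v, if deg ω v = 0 then (1 : ℝ) else 0 :=
    fun ω => by simp [isolCount]
  simp only [h, Finset.mul_sum]
  rw [Finset.sum_comm]
  simp only [sum_prodWeight_isolated, Finset.sum_const, Finset.card_univ, Fintype.card_fin,
    nsmul_eq_mul]

lemma card_edgeIdx_le (n : ℕ) : Fintype.card (EdgeIdx n) ≤ n ^ 2 :=
  (Fintype.card_subtype_le _).trans (by simp [sq])

lemma isolCount_le {n : ℕ} (ω : EdgeIdx n → Bool) : isolCount ω ≤ n :=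
  (Finset.card_le_univ _).trans (by simp)

/-- Bernstein-type right tail bound for the number of isolated vertices. -/
theorem gnp_isolCount_tail_le {n : ℕ} {p M x : ℝ} (hn : 0 < n) (h0 : 0 ≤ p) (h1 : p ≤ 1)
    (hM : n * p ≤ M) (hx : 0 ≤ x) :
    ((gnp n p) {ω | x ≤ (isolCount ω : ℝ) - n * (1 - p) ^ (n - 1)}).toReal
      ≤ exp (-(x ^ 2 / (2 * (8 * M + 2) * n))) := by
  classical
  have hn' : (0 : ℝ) < n := by exact_mod_cast hn
  have hM0 : 0 ≤ M := (by positivity : 0 ≤ n * p).trans hM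
  set m : ℝ := n * (1 - p) ^ (n - 1) with hm
  have hm0 : 0 ≤ m := mul_nonneg hn'.le (pow_nonneg (by linarith) _)
  by_cases hxn : x ≤ n
  swap
  · have : {ω : EdgeIdx n → Bool | x ≤ (isolCount ω : ℝ) - m} = ∅ := by
      ext ω
      have : (isolCount ω : ℝ) ≤ n := by exact_mod_cast isolCount_le ω
      simp only [Set.mem_ofPred_eq, Set.mem_empty_iff_false, iff_false]
      linarith
    rw [this]
    simp [exp_nonneg]
  set A : ℝ := 8 * M + 2 with hA
  have hA0 : 0 < A := by positivity
  set θ : ℝ := x / (A * n) with hθ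
  have hθ0 : 0 ≤ θ := by positivity
  have hθ1 : θ ≤ 1 / 2 := by
    rw [hθ, div_le_iff₀ (by positivity)]
    nlinarith
  have hmgf := sum_prodWeight_exp_le h0 h1 hθ0 hθ1 (EdgeIdx n) _ (boundedDiff_isolCount n)
  rw [sum_prodWeight_isolCount, ← hm] at hmgf
  rw [gnp_toReal_eq h0 h1]
  calc _ ≤ ∑ ω : EdgeIdx n → Bool with ω ∈ {ω | x ≤ (isolCount ω : ℝ) - m},
            prodWeight p ω * exp (θ * isolCount ω) * exp (-(θ * (m + x))) := by
          refine Finset.sum_le_sum fun ω hω => ?_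
          rw [mul_assoc, ← exp_add]
          refine le_mul_of_one_le_right (prodWeight_nonneg h0 h1 ω) (one_le_exp ?_)
          have hω' : x ≤ (isolCount ω : ℝ) - m := by simpa using hω
          nlinarith
    _ ≤ ∑ ω : EdgeIdx n → Bool,
            prodWeight p ω * exp (θ * isolCount ω) * exp (-(θ * (m + x))) :=
          Finset.sum_le_sum_of_subset_of_nonneg (Finset.filter_subset _ _) fun ω _ _ =>
            mul_nonneg (mul_nonneg (prodWeight_nonneg h0 h1 ω) (exp_nonneg _)) (exp_nonneg _)
    _ ≤ exp (θ * m + Fintype.card (EdgeIdx n) * (4 * p * θ ^ 2)) * exp (-(θ * (m + x))) := by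
          rw [← Finset.sum_mul]
          gcongr
    _ ≤ _ := by
          rw [← exp_add]
          apply exp_le_exp.2
          have hcard : (Fintype.card (EdgeIdx n) : ℝ) ≤ n ^ 2 := by
            exact_mod_cast card_edgeIdx_le n
          have hb : (Fintype.card (EdgeIdx n) : ℝ) * (4 * p * θ ^ 2)
              ≤ A / 2 * n * θ ^ 2 := by
            calc _ ≤ (n : ℝ) ^ 2 * (4 * p * θ ^ 2) := by gcongr
              _ = 4 * (n * p) * (n * θ ^ 2) := by ring
              _ ≤ A / 2 * (n * θ ^ 2) := by gcongr; linarith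
              _ = _ := by ring
          have he : A / 2 * n * θ ^ 2 - θ * x = -(x ^ 2 / (2 * A * n)) := by
            rw [hθ]; field_simp; ring
          linarith

/-- The variance of the number of isolated vertices is at least of order `n`. -/
lemma le_variance_factor {n : ℕ} {p : ℝ} (hn : 2 ≤ n) (h0 : 0 < p) (h1 : p < 1) :
    (1 - p) ^ n * min 1 (n * p)
      ≤ (1 - p) ^ (n - 1) * (1 + n * p * (1 - p) ^ (n - 2) - (1 - p) ^ (n - 2)) := by
  have hq : 0 ≤ 1 - p := by linarith
  have hx0 : 0 ≤ (1 - p) ^ (n - 2) := pow_nonneg hq _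
  have hx1 : (1 - p) ^ (n - 2) ≤ 1 := pow_le_one₀ hq (by linarith)
  have hpow : (1 - p) ^ n ≤ (1 - p) ^ (n - 1) :=
    pow_le_pow_of_le_one hq (by linarith) (Nat.sub_le _ _)
  refine mul_le_mul hpow ?_ (le_min zero_le_one (by positivity)) (pow_nonneg hq _)
  have ha := min_le_left 1 ((n : ℝ) * p)
  have hb := min_le_right 1 ((n : ℝ) * p)
  nlinarith

lemma exists_pos_le_variance_factor {c : ℝ} (hc : 0 < c) {p : ℕ → ℝ}
    (hp : ∀ n, 2 ≤ n → p n ∈ Set.Ioo (0 : ℝ) 1)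
    (hlim : Filter.Tendsto (fun n : ℕ => (n : ℝ) * p n) Filter.atTop (nhds c)) :
    ∃ δ : ℝ, 0 < δ ∧ ∀ n : ℕ, 2 ≤ n → δ ≤ (1 - p n) ^ n * min 1 (n * p n) := by
  have hpow : Filter.Tendsto (fun n : ℕ => (1 - p n) ^ n) Filter.atTop (nhds (exp (-c))) := by
    have := Real.tendsto_one_add_pow_exp_of_tendsto (g := fun n => -p n) (t := -c)
      (by simpa using hlim.neg)
    simpa [sub_eq_add_neg] using this
  have hr := hpow.mul ((tendsto_const_nhds (x := (1 : ℝ))).min hlim)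
  obtain ⟨B, hB⟩ := (hr.inv₀ (by positivity)).bddAbove_range
  refine ⟨(max B 1)⁻¹, by positivity, fun n hn => ?_⟩
  obtain ⟨h0, h1⟩ := hp n hn
  have hpos : 0 < (1 - p n) ^ n * min 1 (n * p n) :=
    mul_pos (pow_pos (by linarith) _) (lt_min one_pos (by positivity))
  rw [inv_le_comm₀ (by positivity) hpos]
  exact (hB ⟨n, rfl⟩).trans (le_max_left _ _)

/-- sub-gaussian right tail bound, uniform in `n`, when `n pₙ → c > 0`. -/
theorem right_tail_subgaussian (c : ℝ) (hc : 0 < c) (p : ℕ → ℝ)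
    (hp : ∀ n, 2 ≤ n → p n ∈ Set.Ioo (0 : ℝ) 1)
    (hlim : Filter.Tendsto (fun n : ℕ => (n : ℝ) * p n) Filter.atTop (nhds c)) :
    ∃ k : ℝ, 0 < k ∧ ∀ n : ℕ, 2 ≤ n → ∀ t : ℝ, 0 ≤ t →
      ((gnp n (p n)) {ω |
          t ≤ ((isolCount ω : ℝ) - (n : ℝ) * (1 - p n) ^ (n - 1))
            / Real.sqrt ((n : ℝ) * (1 - p n) ^ (n - 1)
              * (1 + (n : ℝ) * p n * (1 - p n) ^ (n - 2) - (1 - p n) ^ (n - 2)))}).toReal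
        ≤ Real.exp (-k * t ^ 2) := by
  obtain ⟨δ, hδ, hδle⟩ := exists_pos_le_variance_factor hc hp hlim
  obtain ⟨M, hM⟩ := hlim.bddAbove_range
  have hM0 : 0 < M := by
    have h2 := (hp 2 le_rfl).1
    exact (by positivity : (0 : ℝ) < (2 : ℕ) * p 2).trans_le (hM ⟨2, rfl⟩)
  refine ⟨δ / (2 * (8 * M + 2)), by positivity, fun n hn t ht => ?_⟩
  obtain ⟨h0, h1⟩ := hp n hn
  have hn0 : 0 < n := by omega
  have hn' : (0 : ℝ) < n := by exact_mod_cast hn0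
  set σ2 : ℝ := (n : ℝ) * (1 - p n) ^ (n - 1)
      * (1 + (n : ℝ) * p n * (1 - p n) ^ (n - 2) - (1 - p n) ^ (n - 2)) with hσ
  have hσle : n * δ ≤ σ2 := by
    rw [hσ, mul_assoc]
    exact mul_le_mul_of_nonneg_left ((hδle n hn).trans (le_variance_factor hn h0 h1)) hn'.le
  have hσ0 : 0 < σ2 := (by positivity : 0 < n * δ).trans_le hσle
  simp only [le_div_iff₀ (Real.sqrt_pos.2 hσ0)]
  refine (gnp_isolCount_tail_le hn0 h0.le h1.le (hM ⟨n, rfl⟩)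
    (mul_nonneg ht (Real.sqrt_nonneg _))).trans (exp_le_exp.2 ?_)
  rw [mul_pow, Real.sq_sqrt hσ0.le, neg_mul, neg_le_neg_iff, le_div_iff₀ (by positivity)]
  calc δ / (2 * (8 * M + 2)) * t ^ 2 * (2 * (8 * M + 2) * n) = t ^ 2 * (n * δ) := by
        field_simp
    _ ≤ t ^ 2 * σ2 := by gcongr

end ErdosRenyiIsolated
end
end

section
/- Let Y be the number of isolated vertices of the Erdős–Rényi random graph G(n,p) with n ≥ 2 and p ∈ (0,1), with mean μ = n(1−p)^{n−1}, and let m(θ) = E(e^{θY}). Then for all θ ≥ 0, m'(θ) ≤ μ (1 + θ γ_θ / 2) m(θ), where γ_θ = e^θ (p e^θ + 1 − p)^{n−2}(n p e^θ + 1 − p) + (n−1)p + 1. -/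
open MeasureTheory ProbabilityTheory Real Finset

noncomputable section

namespace ErdosRenyiIsolated

/-- The probability of the configuration `ω` under independent Bernoulli(p) coordinates. -/
def weight {ι : Type*} [Fintype ι] (p : ℝ) (ω : ι → Bool) : ℝ :=
  ∏ e, if ω e then p else 1 - p

lemma weight_nonneg {ι : Type*} [Fintype ι] {p : ℝ} (hp : p ∈ Set.Ioo (0 : ℝ) 1)
    (ω : ι → Bool) : 0 ≤ weight p ω := by
  refine Finset.prod_nonneg fun e _ => ?_
  split_ifs
  · exact hp.1.le
  · linarith [hp.2]

lemma weight_mul_weight {ι : Type*} [Fintype ι] (p : ℝ) (a b : ι → Bool) :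
    weight p a * weight p b = weight p (a ⊓ b) * weight p (a ⊔ b) := by
  simp only [weight, ← Finset.prod_mul_distrib]
  refine Finset.prod_congr rfl fun e _ => ?_
  cases ha : a e <;> cases hb : b e <;> simp [ha, hb, mul_comm]

lemma integral_gnp {n : ℕ} {p : ℝ} (hp : p ∈ Set.Ioo (0 : ℝ) 1) (f : (EdgeIdx n → Bool) → ℝ) :
    ∫ ω, f ω ∂(gnp n p) = ∑ ω, weight p ω * f ω := by
  have : IsFiniteMeasure (gnp n p) := by unfold gnp; infer_instance
  rw [integral_fintype (Integrable.of_finite)]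
  refine Finset.sum_congr rfl fun ω _ => ?_
  have h (b : Bool) : (bern p {b}).toReal = if b then p else 1 - p := by
    have h0 := hp.1.le
    have h1 : 0 ≤ 1 - p := by linarith [hp.2]
    cases b <;> simp [bern, h0, h1]
  simp [weight, gnp, Measure.real, Measure.pi_singleton, ENNReal.toReal_prod, h]

/-- Coordinates in `S` are independent of a function that does not depend on them. -/
lemma sum_weight_mul_prod {ι : Type*} [Fintype ι] [DecidableEq ι] (p : ℝ) (S : Finset ι)
    (g : Bool → ℝ) (F : (ι → Bool) → ℝ)
    (hF : ∀ ω ω' : ι → Bool, (∀ e ∉ S, ω e = ω' e) → F ω = F ω') :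
    ∑ ω, weight p ω * ((∏ e ∈ S, g (ω e)) * F ω) =
      (p * g true + (1 - p) * g false) ^ #S * ∑ ω, weight p ω * F ω := by
  have key (g : Bool → ℝ) : ∑ ω, weight p ω * ((∏ e ∈ S, g (ω e)) * F ω) =
      (p * g true + (1 - p) * g false) ^ #S *
        ∑ y : {e // e ∉ S} → Bool, (∏ e, if y e then p else 1 - p) *
          F ((Equiv.piEquivPiSubtypeProd (· ∈ S) fun _ => Bool).symm (fun _ => false, y)) := by
    have hx : (p * g true + (1 - p) * g false) ^ #S =
        ∑ x : {e // e ∈ S} → Bool, ∏ e, ((if x e then p else 1 - p) * g (x e)) := by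
      rw [← Fintype.piFinset_univ,
        ← Finset.prod_univ_sum (fun _ => univ)
          (fun _ b => (if b = true then p else 1 - p) * g b)]
      simp
    rw [hx, Finset.sum_mul_sum, ← (Equiv.piEquivPiSubtypeProd (· ∈ S) fun _ => Bool).symm.sum_comp,
      Fintype.sum_prod_type]
    refine Finset.sum_congr rfl fun x _ => Finset.sum_congr rfl fun y _ => ?_
    have hF' := hF ((Equiv.piEquivPiSubtypeProd (· ∈ S) fun _ => Bool).symm (x, y))
      ((Equiv.piEquivPiSubtypeProd (· ∈ S) fun _ => Bool).symm (fun _ => false, y))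
      (fun e he => by simp [he])
    rw [hF', ← Finset.prod_coe_sort S, Finset.prod_mul_distrib]
    have h1 (e : {e // e ∈ S}) : (Equiv.piEquivPiSubtypeProd (· ∈ S) fun _ => Bool).symm (x, y) e
      = x e := by simp
    have h2 (e : {e // e ∉ S}) : (Equiv.piEquivPiSubtypeProd (· ∈ S) fun _ => Bool).symm (x, y) e
      = y e := by simp [e.2]
    have h3 : weight p ((Equiv.piEquivPiSubtypeProd (· ∈ S) fun _ => Bool).symm (x, y)) =
        (∏ e, if x e then p else 1 - p) * ∏ e, if y e then p else 1 - p := by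
      rw [weight, ← Fintype.prod_subtype_mul_prod_subtype (· ∈ S)]
      simp only [h1, h2]
      congr!
    simp only [h1, h3]
    ring
  have h1 := key fun _ => 1
  simp only [Finset.prod_const_one, one_mul, mul_one, add_sub_cancel, one_pow] at h1
  rw [key, h1]

lemma sum_weight {ι : Type*} [Fintype ι] [DecidableEq ι] (p : ℝ) :
    ∑ ω : ι → Bool, weight p ω = 1 := by
  have h := Finset.prod_univ_sum (fun _ : ι => (univ : Finset Bool))
    (fun _ b => if b = true then p else 1 - p)
  rw [Fintype.piFinset_univ] at h
  simpa [weight] using h.symm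

/-- The Harris inequality for an increasing and a decreasing function. -/
lemma sum_weight_mul_le {ι : Type*} [Fintype ι] [DecidableEq ι] {p : ℝ}
    (hp : p ∈ Set.Ioo (0 : ℝ) 1) {f g : (ι → Bool) → ℝ} (hf₀ : 0 ≤ f)
    (hf : Monotone f) (hg : Antitone g) :
    ∑ ω, weight p ω * (f ω * g ω) ≤ (∑ ω, weight p ω * f ω) * ∑ ω, weight p ω * g ω := by
  have h := fkg f (fun ω => g ⊥ - g ω) (weight p) (fun ω => weight_nonneg hp ω) hf₀
    (fun ω => sub_nonneg.2 (hg bot_le)) hf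
    (fun a b hab => sub_le_sub_left (hg hab) _) (fun a b => (weight_mul_weight p a b).le)
  simp only [mul_sub, Finset.sum_sub_distrib, sum_weight, ← mul_assoc, ← Finset.sum_mul,
    one_mul] at h ⊢
  linarith

lemma hasDerivAt_sum_exp {α : Type*} [Fintype α] (w X : α → ℝ) (θ : ℝ) :
    HasDerivAt (fun s => ∑ a, w a * exp (s * X a)) (∑ a, w a * (X a * exp (θ * X a))) θ := by
  refine HasDerivAt.fun_sum fun a _ => ?_
  exact ((((hasDerivAt_id' θ).mul_const (X a)).exp).const_mul (w a)).congr_deriv (by ring)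

lemma exp_sub_exp_le {x y : ℝ} (h : x ≤ y) :
    exp y - exp x ≤ (y - x) * (exp y + exp x) / 2 := by
  have hd (t : ℝ) : HasDerivAt (fun t => t * (exp t + 1) / 2 - exp t)
      ((1 + (t - 1) * exp t) / 2) t := by
    exact ((((hasDerivAt_id' t).mul ((hasDerivAt_exp t).add_const 1)).div_const 2).sub
      (hasDerivAt_exp t)).congr_deriv (by ring)
  have hm : Monotone fun t => t * (exp t + 1) / 2 - exp t := by
    refine monotone_of_hasDerivAt_nonneg hd fun t => ?_
    have h1 := mul_le_mul_of_nonneg_right (add_one_le_exp (-t)) (exp_pos t).le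
    rw [← exp_add, neg_add_cancel, exp_zero] at h1
    show 0 ≤ (1 + (t - 1) * exp t) / 2
    linarith
  have h2 := hm (sub_nonneg.2 h)
  have h3 : exp y = exp (y - x) * exp x := by rw [← exp_add, sub_add_cancel]
  simp only [exp_zero] at h2
  rw [h3]
  nlinarith [exp_pos x]

/-- The potential edges incident to `v`. -/
def incidentEdges {n : ℕ} (v : Fin n) : Finset (EdgeIdx n) :=
  univ.filter fun e => e.1.1 = v ∨ e.1.2 = v

lemma adj_comm {n : ℕ} (ω : EdgeIdx n → Bool) (u v : Fin n) : adj ω u v ↔ adj ω v u := by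
  unfold adj
  rcases lt_trichotomy u v with h | h | h
  · simp [h, h.not_gt]
  · simp [h]
  · simp [h, h.not_gt]

lemma adj_mono {n : ℕ} {ω ω' : EdgeIdx n → Bool} (h : ω ≤ ω') {u v : Fin n}
    (ha : adj ω u v) : adj ω' u v := by
  unfold adj at *
  split_ifs at * with h1 h2
  · exact h _ ha
  · exact h _ ha

lemma adj_congr {n : ℕ} {ω ω' : EdgeIdx n → Bool} {x u v : Fin n}
    (h : ∀ e ∉ incidentEdges x, ω e = ω' e) (hu : u ≠ x) (hv : v ≠ x) :
    adj ω u v ↔ adj ω' u v := by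
  unfold adj
  split_ifs with h1 h2
  · rw [h ⟨(u, v), h1⟩ (by simp [incidentEdges, hu, hv])]
  · rw [h ⟨(v, u), h2⟩ (by simp [incidentEdges, hu, hv])]
  · rfl

lemma deg_mono {n : ℕ} {ω ω' : EdgeIdx n → Bool} (h : ω ≤ ω') (v : Fin n) :
    deg ω v ≤ deg ω' v :=
  Finset.card_le_card (Finset.monotone_filter_right _ fun _ _ ha => adj_mono h ha)

lemma isolCount_anti {n : ℕ} : Antitone (isolCount (n := n)) := fun _ _ h =>
  Finset.card_le_card (Finset.monotone_filter_right _ fun v _ hv =>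
    Nat.le_zero.1 (hv ▸ deg_mono h v))

lemma deg_eq_card {n : ℕ} (ω : EdgeIdx n → Bool) (v : Fin n) :
    deg ω v = #{e ∈ incidentEdges v | ω e = true} := by
  symm
  refine Finset.card_bij (fun e _ => if e.1.1 = v then e.1.2 else e.1.1) ?_ ?_ ?_
  · rintro ⟨⟨a, b⟩, hab⟩ he
    simp only [incidentEdges, mem_filter, mem_univ, true_and] at he hab ⊢
    unfold adj
    rcases he with ⟨rfl | rfl, he⟩
    · simp [hab, he]
    · simp [hab, hab.ne, hab.not_gt, he]
  · rintro ⟨⟨a, b⟩, hab⟩ he ⟨⟨c, d⟩, hcd⟩ he'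
    simp only [incidentEdges, mem_filter, mem_univ, true_and] at he he' hab hcd ⊢
    intro h
    simp only [Subtype.mk.injEq, Prod.mk.injEq]
    split_ifs at h <;> grind
  · intro w hw
    replace hw := (mem_filter.1 hw).2
    unfold adj at hw
    split_ifs at hw with h1 h2
    · exact ⟨⟨(v, w), h1⟩, by simp [incidentEdges, hw], by simp⟩
    · exact ⟨⟨(w, v), h2⟩, by simp [incidentEdges, hw], by simp [h2.ne]⟩

lemma card_incidentEdges {n : ℕ} (v : Fin n) : #(incidentEdges v) = n - 1 := by
  have h := deg_eq_card (fun _ => true) v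
  simp only [filter_true] at h
  have h1 : (univ.filter fun w => adj (fun _ : EdgeIdx n => true) v w) = univ.erase v := by
    ext w
    rcases lt_trichotomy v w with h | rfl | h
    · simp [adj, h, h.ne']
    · simp [adj]
    · simp [adj, h, h.ne]
  rw [← h, deg, h1, card_erase_of_mem (mem_univ v), card_univ, Fintype.card_fin]

lemma isolCountDel_congr {n : ℕ} {v : Fin n} {ω ω' : EdgeIdx n → Bool}
    (h : ∀ e ∉ incidentEdges v, ω e = ω' e) : isolCountDel ω v = isolCountDel ω' v := by
  have h1 (a b : Fin n) : adjDel ω v a b ↔ adjDel ω' v a b :=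
    and_congr_left fun hab => adj_congr h hab.1 hab.2
  simp only [isolCountDel, degDel, h1]
  congr!

lemma degDel_le_deg {n : ℕ} (ω : EdgeIdx n → Bool) (v u : Fin n) : degDel ω v u ≤ deg ω u :=
  Finset.card_le_card (Finset.monotone_filter_right _ fun _ _ ha => ha.1)

lemma isolCount_le_isolCountDel {n : ℕ} (ω : EdgeIdx n → Bool) (v : Fin n) :
    isolCount ω ≤ isolCountDel ω v :=
  Finset.card_le_card (Finset.monotone_filter_right _ fun u _ hu =>
    Nat.le_zero.1 (hu ▸ degDel_le_deg ω v u))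

lemma isolCountDel_le {n : ℕ} (ω : EdgeIdx n → Bool) (v : Fin n) :
    isolCountDel ω v ≤ isolCount ω + (1 + deg ω v) := by
  have hsub : (univ.filter fun u => degDel ω v u = 0) ⊆
      (univ.filter fun u => deg ω u = 0) ∪ ({v} ∪ univ.filter fun w => adj ω v w) := by
    intro u hu
    simp only [degDel, deg, card_eq_zero, filter_eq_empty_iff, mem_filter, mem_univ, true_and,
      forall_const, mem_union, mem_singleton] at hu ⊢
    by_contra! hc
    obtain ⟨⟨w, hw⟩, huv, hvu⟩ := hc
    refine hu (x := w) ⟨hw, huv, ?_⟩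
    rintro rfl
    exact hvu ((adj_comm ω _ _).1 hw)
  refine (Finset.card_le_card hsub).trans ((card_union_le _ _).trans ?_)
  exact Nat.add_le_add_left (card_union_le _ _) _

lemma isolCountDel_of_deg_eq_zero {n : ℕ} {ω : EdgeIdx n → Bool} {v : Fin n}
    (h : deg ω v = 0) : isolCountDel ω v = isolCount ω := by
  simp only [deg, card_eq_zero, filter_eq_empty_iff, mem_univ, forall_const] at h
  have h1 (a b : Fin n) : adjDel ω v a b ↔ adj ω a b := by
    refine and_iff_left_of_imp fun hab => ⟨?_, ?_⟩
    · rintro rfl; exact h hab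
    · rintro rfl; exact h ((adj_comm ω _ _).1 hab)
  simp only [isolCountDel, isolCount, degDel, deg, h1]
  congr!

lemma sum_weight_isolated {n : ℕ} (p θ : ℝ) (v : Fin n) :
    ∑ ω, weight p ω * ((if deg ω v = 0 then 1 else 0) * exp (θ * isolCount ω)) =
      (1 - p) ^ (n - 1) * ∑ ω, weight p ω * exp (θ * isolCountDel ω v) := by
  have h := sum_weight_mul_prod p (incidentEdges v) (fun b => if b then 0 else 1)
    (fun ω => exp (θ * isolCountDel ω v)) (fun ω ω' h => by rw [isolCountDel_congr h])
  simp only [card_incidentEdges, if_true, mul_zero, zero_add, Bool.false_eq_true, if_false,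
    mul_one] at h
  rw [← h]
  refine Finset.sum_congr rfl fun ω _ => ?_
  have hd : deg ω v = 0 ↔ ∀ e ∈ incidentEdges v, ω e = false := by
    simp [deg_eq_card, filter_eq_empty_iff]
  by_cases h0 : deg ω v = 0
  · rw [if_pos h0, isolCountDel_of_deg_eq_zero h0,
      Finset.prod_eq_one fun e he => by simp [hd.1 h0 e he]]
  · rw [if_neg h0]
    obtain ⟨e, he, hω⟩ : ∃ e ∈ incidentEdges v, ω e = true := by simpa [hd] using h0
    rw [Finset.prod_eq_zero he (by simp [hω]), zero_mul, zero_mul]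

lemma sum_weight_exp_deg {n : ℕ} (p s : ℝ) (v : Fin n) :
    ∑ ω, weight p ω * exp (s * (1 + deg ω v)) =
      exp s * (p * exp s + 1 - p) ^ (n - 1) := by
  have h := sum_weight_mul_prod p (incidentEdges v) (fun b => if b then exp s else 1)
    (fun _ => exp s) (fun _ _ _ => rfl)
  simp only [card_incidentEdges, if_true, Bool.false_eq_true, if_false,
    mul_one, ← Finset.sum_mul, sum_weight, one_mul] at h
  rw [mul_comm, add_sub_assoc, ← h]
  refine Finset.sum_congr rfl fun ω _ => ?_
  rw [Finset.prod_ite, Finset.prod_const_one, mul_one, Finset.prod_const, ← deg_eq_card,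
    ← exp_nat_mul, ← exp_add]
  ring_nf

lemma sum_weight_deg_mul_exp {n : ℕ} (hn : 2 ≤ n) (p θ : ℝ) (v : Fin n) :
    ∑ ω, weight p ω * ((1 + deg ω v) * exp (θ * (1 + deg ω v))) =
      exp θ * (p * exp θ + 1 - p) ^ (n - 2) * (n * p * exp θ + 1 - p) := by
  have h := hasDerivAt_sum_exp (fun ω : EdgeIdx n → Bool => weight p ω)
    (fun ω => (1 + deg ω v : ℝ)) θ
  simp only [sum_weight_exp_deg] at h
  refine h.unique ?_
  obtain ⟨k, rfl⟩ := Nat.exists_eq_add_of_le' hn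
  refine ((hasDerivAt_exp θ).mul
    (((((hasDerivAt_exp θ).const_mul p).add_const 1).sub_const p).pow (k + 1))).congr_deriv ?_
  push_cast [Pi.pow_apply]
  ring

lemma sum_weight_deg_mul_exp_isolCount_le {n : ℕ} (hn : 2 ≤ n) {p s θ : ℝ}
    (hp : p ∈ Set.Ioo (0 : ℝ) 1) (hs : 0 ≤ s) (hθ : 0 ≤ θ) (v : Fin n) :
    ∑ ω, weight p ω * ((1 + deg ω v) * exp (s * (1 + deg ω v)) * exp (θ * isolCount ω)) ≤
      exp s * (p * exp s + 1 - p) ^ (n - 2) * (n * p * exp s + 1 - p) *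
        ∑ ω : EdgeIdx n → Bool, weight p ω * exp (θ * isolCount ω) := by
  rw [← sum_weight_deg_mul_exp hn p s v]
  refine sum_weight_mul_le hp (fun ω => by positivity) (fun a b hab => ?_) (fun a b hab => ?_)
  · have h : (deg a v : ℝ) ≤ deg b v := by exact_mod_cast deg_mono hab v
    gcongr
  · have h : (isolCount b : ℝ) ≤ isolCount a := by exact_mod_cast isolCount_anti hab
    gcongr

lemma sum_weight_exp_isolCountDel_le {n : ℕ} (hn : 2 ≤ n) {p θ : ℝ}
    (hp : p ∈ Set.Ioo (0 : ℝ) 1) (hθ : 0 ≤ θ) (v : Fin n) :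
    ∑ ω, weight p ω * exp (θ * isolCountDel ω v) ≤
      (1 + θ * (exp θ * (p * exp θ + 1 - p) ^ (n - 2) * (n * p * exp θ + 1 - p)
        + (n - 1) * p + 1) / 2) * ∑ ω : EdgeIdx n → Bool, weight p ω * exp (θ * isolCount ω) := by
  have hpt (ω : EdgeIdx n → Bool) : exp (θ * isolCountDel ω v) ≤ exp (θ * isolCount ω) +
      θ / 2 * ((1 + deg ω v) * exp (θ * (1 + deg ω v)) * exp (θ * isolCount ω) +
        (1 + deg ω v) * exp (0 * (1 + deg ω v)) * exp (θ * isolCount ω)) := by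
    have h1 : (isolCount ω : ℝ) ≤ isolCountDel ω v := by
      exact_mod_cast isolCount_le_isolCountDel ω v
    have h2 : (isolCountDel ω v : ℝ) ≤ isolCount ω + (1 + deg ω v) := by
      exact_mod_cast isolCountDel_le ω v
    have h3 := exp_sub_exp_le (mul_le_mul_of_nonneg_left h1 hθ)
    have h4 : exp (θ * isolCountDel ω v) ≤ exp (θ * (1 + deg ω v)) * exp (θ * isolCount ω) := by
      rw [← exp_add, ← mul_add, add_comm (1 + (deg ω v : ℝ))]
      gcongr
    have h5 : (θ * isolCountDel ω v - θ * isolCount ω) *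
        (exp (θ * isolCountDel ω v) + exp (θ * isolCount ω)) ≤ (θ * (1 + deg ω v)) *
        (exp (θ * (1 + deg ω v)) * exp (θ * isolCount ω) + exp (θ * isolCount ω)) := by
      gcongr
      rw [← mul_sub]
      gcongr
      linarith
    rw [zero_mul, exp_zero]
    linarith
  have hsum := Finset.sum_le_sum fun ω (_ : ω ∈ univ) =>
    mul_le_mul_of_nonneg_left (hpt ω) (weight_nonneg hp ω)
  have hA := sum_weight_deg_mul_exp_isolCount_le hn hp hθ hθ v
  have hB := sum_weight_deg_mul_exp_isolCount_le hn hp le_rfl hθ v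
  rw [exp_zero, mul_one, add_sub_cancel_left, one_pow, mul_one, mul_one, one_mul] at hB
  have hsplit (ω : EdgeIdx n → Bool) (a b c : ℝ) : weight p ω * (a + θ / 2 * (b + c)) =
      weight p ω * a + θ / 2 * (weight p ω * b + weight p ω * c) := by ring
  simp only [hsplit, Finset.sum_add_distrib, ← Finset.mul_sum] at hsum
  have h := mul_le_mul_of_nonneg_left (add_le_add hA hB) (div_nonneg hθ zero_le_two)
  linarith

/-- differential inequality for the mgf `m(θ) = E e^{θY}`, `θ ≥ 0`. -/
theorem deriv_mgf_bound_nonneg (n : ℕ) (hn : 2 ≤ n) (p : ℝ)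
    (hp : p ∈ Set.Ioo (0 : ℝ) 1)
    (μ : ℝ) (hμ : μ = (n : ℝ) * (1 - p) ^ (n - 1))
    (γ : ℝ → ℝ)
    (hγ : ∀ θ, γ θ = Real.exp θ * (p * Real.exp θ + 1 - p) ^ (n - 2)
      * ((n : ℝ) * p * Real.exp θ + 1 - p) + ((n : ℝ) - 1) * p + 1)
    (m : ℝ → ℝ) (hm : ∀ θ, m θ = ∫ ω, Real.exp (θ * (isolCount ω : ℝ)) ∂(gnp n p)) :
    ∀ θ : ℝ, 0 ≤ θ → deriv m θ ≤ μ * (1 + θ * γ θ / 2) * m θ := by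
  intro θ hθ
  have hm' : m = fun s => ∑ ω : EdgeIdx n → Bool, weight p ω * exp (s * isolCount ω) :=
    funext fun s => (hm s).trans (integral_gnp hp _)
  have hderiv : deriv m θ = ∑ v : Fin n, (1 - p) ^ (n - 1) *
      ∑ ω, weight p ω * exp (θ * isolCountDel ω v) := by
    rw [hm', (hasDerivAt_sum_exp _ _ θ).deriv]
    simp only [← sum_weight_isolated]
    rw [Finset.sum_comm]
    refine Finset.sum_congr rfl fun ω _ => ?_
    rw [← Finset.mul_sum, ← Finset.sum_mul, Finset.sum_boole, isolCount]
  have hq : 0 ≤ (1 - p) ^ (n - 1) := pow_nonneg (by linarith [hp.2]) _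
  rw [hderiv]
  refine (Finset.sum_le_sum fun v _ => mul_le_mul_of_nonneg_left
    (sum_weight_exp_isolCountDel_le hn hp hθ v) hq).trans_eq ?_
  rw [Finset.sum_const, card_univ, Fintype.card_fin, nsmul_eq_mul, hm', hμ, hγ]
  ring

end ErdosRenyiIsolated
end
end
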